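/- arXiv:1605.06839 — 2 statements merged into one kernel-verified Lean document; each statement's English description precedes it below -/
import Mathlib

section
/- Let n ≥ 1 be an integer, s ∈ (0,1], ε ≥ 0, χ ∈ ℂⁿ and θ ∈ ℝ with 0 < |θ| < 2π. Then the map Γ_s^ε is differentiable at (χ,θ), and the determinant of its derivative equals Jac(Γ_s^ε)(χ,θ) = 2^{2n+2}·s·|χ|²·(sin(θs/2)/θ)^{2n−1}·(sin(θs/2) − (θs/2)·cos(θs/2))/θ³ + 2^{2n}·(ε²/4)·s·(sin(θs/2)/θ)^{2n}. -/
open Real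

/-- The geodesic-endpoint map `Γ_s^ε : ℂⁿ × ℝ → ℂⁿ × ℝ` of the Riemannian approximation
`M^ε` of the Heisenberg group `ℍⁿ`. -/
noncomputable def heisenbergGamma (n : ℕ) (s ε : ℝ)
    (p : EuclideanSpace ℂ (Fin n) × ℝ) : EuclideanSpace ℂ (Fin n) × ℝ :=
  if p.2 = 0 then ((s : ℂ) • p.1, 0)
  else
    ((Complex.I * ((Complex.exp (-Complex.I * ((p.2 * s : ℝ) : ℂ)) - 1) / ((p.2 : ℝ) : ℂ))) • p.1,
      ε ^ 2 * (p.2 * s) / 4 + 2 * ‖p.1‖ ^ 2 * (p.2 * s - Real.sin (p.2 * s)) / p.2 ^ 2)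


theorem det_block {E : Type*} [AddCommGroup E] [Module ℝ E] [Module.Finite ℝ E]
    (A : E →ₗ[ℝ] E) (u : E) (l : E →ₗ[ℝ] ℝ) (d : ℝ) (L : (E × ℝ) →ₗ[ℝ] (E × ℝ))
    (hL : ∀ v t, L (v, t) = (A v + t • A u, l v + d * t)) :
    LinearMap.det L = LinearMap.det A * (d - l u) := by
  have h : L = (A.prodMap LinearMap.id) ∘ₗ
      (LinearMap.transvection (l ∘ₗ LinearMap.fst ℝ E ℝ + (d - l u - 1) • LinearMap.snd ℝ E ℝ)
        ((0, 1) : E × ℝ)) ∘ₗ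
      (LinearMap.transvection (LinearMap.snd ℝ E ℝ) ((u, 0) : E × ℝ)) := by
    apply LinearMap.ext
    rintro ⟨v, t⟩
    rw [hL]
    ext
    · simp [LinearMap.transvection.apply]
    · simp [LinearMap.transvection.apply]
      ring
  rw [h, LinearMap.det_comp, LinearMap.det_comp, LinearMap.det_prodMap,
    LinearMap.transvection.det, LinearMap.transvection.det]
  simp

theorem det_csmul (n : ℕ) (a : ℂ) :
    LinearMap.det ((a • (LinearMap.id : EuclideanSpace ℂ (Fin n) →ₗ[ℂ] _)).restrictScalars ℝ)
      = (Complex.normSq a) ^ n := by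
  rw [LinearMap.det_restrictScalars, Algebra.norm_complex_apply]
  simp

theorem inner_csmul (n : ℕ) (a : ℂ) (χ : EuclideanSpace ℂ (Fin n)) :
    inner ℝ χ (a • χ) = a.re * ‖χ‖ ^ 2 := by
  rw [EuclideanSpace.norm_sq_eq, PiLp.inner_apply, Finset.mul_sum]
  refine Finset.sum_congr rfl fun i _ => ?_
  rw [← Complex.normSq_eq_norm_sq, Complex.normSq_apply]
  simp [Complex.inner]
  ring

theorem hasDeriv_a (s θ : ℝ) (hθ : θ ≠ 0) :
    HasDerivAt (fun t : ℝ => Complex.I * ((Complex.exp (-Complex.I * ((t * s : ℝ) : ℂ)) - 1) / (t : ℂ)))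
      (Complex.I * ((Complex.exp (-Complex.I * ((θ * s : ℝ) : ℂ)) * (-Complex.I * s) * θ
        - (Complex.exp (-Complex.I * ((θ * s : ℝ) : ℂ)) - 1)) / (θ : ℂ) ^ 2)) θ := by
  have h0 : HasDerivAt (fun t : ℝ => (t : ℂ)) 1 θ := Complex.ofRealCLM.hasDerivAt
  have h1 : HasDerivAt (fun t : ℝ => -Complex.I * ((t * s : ℝ) : ℂ)) (-Complex.I * s) θ := by
    have := (h0.mul_const (s : ℂ)).const_mul (-Complex.I)
    simpa using this
  have h2 := ((h1.cexp.sub_const 1).div h0 (by exact_mod_cast hθ)).const_mul Complex.I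
  simpa using h2

theorem hasDeriv_g (s θ : ℝ) (hθ : θ ≠ 0) :
    HasDerivAt (fun t : ℝ => (t * s - Real.sin (t * s)) / t ^ 2)
      (4 * Real.cos (θ * s / 2) * (Real.sin (θ * s / 2) - θ * s / 2 * Real.cos (θ * s / 2))
        / θ ^ 3) θ := by
  have h1 : HasDerivAt (fun t : ℝ => t * s) s θ := by
    simpa using (hasDerivAt_id θ).mul_const s
  have h2 := (h1.sub h1.sin).div (hasDerivAt_pow 2 θ) (pow_ne_zero 2 hθ)
  refine h2.congr_deriv ?_
  have e : θ * s = 2 * (θ * s / 2) := by ring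
  have es : Real.sin (θ * s) = 2 * Real.sin (θ * s / 2) * Real.cos (θ * s / 2) := by
    conv_lhs => rw [e, Real.sin_two_mul]
  have ec : Real.cos (θ * s) = 2 * Real.cos (θ * s / 2) ^ 2 - 1 := by
    conv_lhs => rw [e, Real.cos_two_mul]
  simp only [Pi.sub_apply]
  rw [es, ec]
  field_simp
  ring

theorem a_eq (s θ : ℝ) (hθ : θ ≠ 0) :
    Complex.I * ((Complex.exp (-Complex.I * ((θ * s : ℝ) : ℂ)) - 1) / (θ : ℂ)) =
      ⟨2 * Real.sin (θ * s / 2) * Real.cos (θ * s / 2) / θ, -2 * Real.sin (θ * s / 2) ^ 2 / θ⟩ := by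
  have e : θ * s = 2 * (θ * s / 2) := by ring
  have h : Complex.exp (-Complex.I * ((θ * s : ℝ) : ℂ)) =
     ⟨1 - 2 * Real.sin (θ * s / 2) ^ 2, - (2 * Real.sin (θ * s / 2) * Real.cos (θ * s / 2))⟩ := by
    have e1 : -Complex.I * ((θ * s : ℝ) : ℂ) = ((-(2 * (θ * s / 2)) : ℝ) : ℂ) * Complex.I := by
      push_cast; ring
    rw [e1]
    apply Complex.ext
    · rw [Complex.exp_ofReal_mul_I_re, Real.cos_neg, Real.cos_two_mul]
      have := Real.sin_sq_add_cos_sq (θ * s / 2)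
      simp only; linarith
    · rw [Complex.exp_ofReal_mul_I_im, Real.sin_neg, Real.sin_two_mul]
  rw [h]
  apply Complex.ext <;> simp <;> ring

theorem aDeriv_eq (s θ : ℝ) (hθ : θ ≠ 0) (hS : Real.sin (θ * s / 2) ≠ 0) :
    (Complex.I * ((Complex.exp (-Complex.I * ((θ * s : ℝ) : ℂ)) * (-Complex.I * s) * θ
        - (Complex.exp (-Complex.I * ((θ * s : ℝ) : ℂ)) - 1)) / (θ : ℂ) ^ 2)) =
    (Complex.I * ((Complex.exp (-Complex.I * ((θ * s : ℝ) : ℂ)) - 1) / (θ : ℂ))) *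
      ⟨-(Real.sin (θ * s / 2) - θ * s / 2 * Real.cos (θ * s / 2)) / (Real.sin (θ * s / 2) * θ),
        -s / 2⟩ := by
  have hc : (θ : ℂ) ≠ 0 := by exact_mod_cast hθ
  have h : Complex.exp (-Complex.I * ((θ * s : ℝ) : ℂ)) =
      1 - Complex.I * θ * (Complex.I * ((Complex.exp (-Complex.I * ((θ * s : ℝ) : ℂ)) - 1) / (θ : ℂ))) := by
    field_simp
    generalize Complex.exp _ = x
    linear_combination (x - 1) * Complex.I_sq
  have h2 := a_eq s θ hθ
  generalize Complex.I * ((Complex.exp (-Complex.I * ((θ * s : ℝ) : ℂ)) - 1) / (θ : ℂ)) = a at *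
  rw [h]
  have e2 : Complex.I * (((1 - Complex.I * θ * a) * (-Complex.I * s) * θ
        - (1 - Complex.I * θ * a - 1)) / (θ : ℂ) ^ 2) =
      ((1 - Complex.I * θ * a) * s - a) * ((θ⁻¹ : ℝ) : ℂ) := by
    push_cast
    field_simp
    linear_combination (- (1 - Complex.I * θ * a) * s + a) * θ * Complex.I_sq
  rw [e2, h2]
  have sc := Real.sin_sq_add_cos_sq (θ * s / 2)
  generalize Real.sin (θ * s / 2) = S at *
  generalize Real.cos (θ * s / 2) = C at *
  have sc' : C ^ 2 = 1 - S ^ 2 := by linarith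
  apply Complex.ext
  · simp
    field_simp
    ring_nf
    simp only [sc']
    ring
  · simp
    field_simp
    ring_nf

/-- For `n ≥ 1`, `s ∈ (0,1]`, `ε ≥ 0`, `χ ∈ ℂⁿ` and `0 < |θ| < 2π`, the map `Γ_s^ε` is
differentiable at `(χ,θ)` and the determinant of its (real) Fréchet derivative equals
`2^{2n+2} s |χ|² (sin(θs/2)/θ)^{2n−1} (sin(θs/2) − (θs/2)cos(θs/2))/θ³
  + 2^{2n} (ε²/4) s (sin(θs/2)/θ)^{2n}`. -/
theorem heisenbergGamma_jacobian (n : ℕ) (hn : 1 ≤ n) (s ε : ℝ) (hs : s ∈ Set.Ioc (0 : ℝ) 1)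
    (hε : 0 ≤ ε) (χ : EuclideanSpace ℂ (Fin n)) (θ : ℝ) (hθ₀ : 0 < |θ|)
    (hθ : |θ| < 2 * Real.pi) :
    DifferentiableAt ℝ (heisenbergGamma n s ε) (χ, θ) ∧
      LinearMap.det (fderiv ℝ (heisenbergGamma n s ε) (χ, θ)).toLinearMap =
        2 ^ (2 * n + 2) * s * ‖χ‖ ^ 2 * (Real.sin (θ * s / 2) / θ) ^ (2 * n - 1) *
            ((Real.sin (θ * s / 2) - θ * s / 2 * Real.cos (θ * s / 2)) / θ ^ 3) +
          2 ^ (2 * n) * (ε ^ 2 / 4) * s * (Real.sin (θ * s / 2) / θ) ^ (2 * n) := by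
  have hθ1 : θ ≠ 0 := abs_pos.mp hθ₀
  obtain ⟨hs0, hs1⟩ := hs
  have hS : Real.sin (θ * s / 2) ≠ 0 := by
    have hx : |θ * s / 2| < Real.pi := by
      rw [abs_div, abs_mul, abs_of_pos hs0, abs_two]
      nlinarith
    rw [abs_lt] at hx
    intro h0
    rw [Real.sin_eq_zero_iff_of_lt_of_lt hx.1 hx.2] at h0
    have : θ * s ≠ 0 := mul_ne_zero hθ1 (ne_of_gt hs0)
    exact this (by linarith)
  have ha := hasDeriv_a s θ hθ1
  rw [aDeriv_eq s θ hθ1 hS] at ha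
  have haeq := a_eq s θ hθ1
  have hg := hasDeriv_g s θ hθ1
  set af : ℝ → ℂ := fun t : ℝ =>
    Complex.I * ((Complex.exp (-Complex.I * ((t * s : ℝ) : ℂ)) - 1) / (t : ℂ)) with haf
  set gf : ℝ → ℝ := fun t : ℝ => (t * s - Real.sin (t * s)) / t ^ 2 with hgf
  change af θ = _ at haeq
  change HasDerivAt af (af θ * _) θ at ha
  set w : ℂ := ⟨-(Real.sin (θ * s / 2) - θ * s / 2 * Real.cos (θ * s / 2)) /
    (Real.sin (θ * s / 2) * θ), -s / 2⟩ with hw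
  set gd := 4 * Real.cos (θ * s / 2) *
    (Real.sin (θ * s / 2) - θ * s / 2 * Real.cos (θ * s / 2)) / θ ^ 3 with hgd
  have hev : heisenbergGamma n s ε =ᶠ[nhds (χ, θ)]
      fun p => (af p.2 • p.1, ε ^ 2 * s / 4 * p.2 + (2 * ‖p.1‖ ^ 2) * gf p.2) := by
    have : ∀ᶠ p : EuclideanSpace ℂ (Fin n) × ℝ in nhds (χ, θ), p.2 ≠ 0 :=
      continuous_snd.continuousAt.eventually_ne hθ1
    filter_upwards [this] with p hp
    simp only [heisenbergGamma, if_neg hp, haf, hgf]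
    congr 1
    ring
  have hfst : HasFDerivAt (fun p : EuclideanSpace ℂ (Fin n) × ℝ => p.1)
    (ContinuousLinearMap.fst ℝ (EuclideanSpace ℂ (Fin n)) ℝ) (χ, θ) := hasFDerivAt_fst
  have hsnd : HasFDerivAt (fun p : EuclideanSpace ℂ (Fin n) × ℝ => p.2)
    (ContinuousLinearMap.snd ℝ (EuclideanSpace ℂ (Fin n)) ℝ) (χ, θ) := hasFDerivAt_snd
  have hA := HasFDerivAt.comp ((χ, θ) : EuclideanSpace ℂ (Fin n) × ℝ) ha.hasFDerivAt hsnd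
  have hG := HasDerivAt.comp_hasFDerivAt ((χ, θ) : EuclideanSpace ℂ (Fin n) × ℝ) hg hsnd
  have h1 := hA.smul hfst
  have h2 := (hsnd.const_mul (ε ^ 2 * s / 4)).add ((hfst.norm_sq.const_mul 2).mul hG)
  have hD := (h1.prodMk h2).congr_of_eventuallyEq hev
  refine ⟨hD.differentiableAt, ?_⟩
  rw [hD.fderiv]
  rw [det_block ((af θ • (LinearMap.id : EuclideanSpace ℂ (Fin n) →ₗ[ℂ] _)).restrictScalars ℝ)
    (w • χ) ((4 * gf θ) • (innerSL ℝ χ).toLinearMap) (ε ^ 2 * s / 4 + 2 * ‖χ‖ ^ 2 * gd) _ ?_]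
  · rw [det_csmul]
    have hl : ((4 * gf θ) • (innerSL ℝ χ).toLinearMap) (w • χ) = 4 * gf θ * (w.re * ‖χ‖ ^ 2) := by
      rw [← inner_csmul]
      rfl
    have hn2 : Complex.normSq (af θ) = 4 * (Real.sin (θ * s / 2) / θ) ^ 2 := by
      rw [haeq, Complex.normSq_mk]
      have sc := Real.sin_sq_add_cos_sq (θ * s / 2)
      have sc' : Real.cos (θ * s / 2) ^ 2 = 1 - Real.sin (θ * s / 2) ^ 2 := by linarith
      field_simp
      rw [sc']
      ring
    have hgθ : gf θ = (θ * s - 2 * Real.sin (θ * s / 2) * Real.cos (θ * s / 2)) / θ ^ 2 := by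
      rw [← Real.sin_two_mul]
      simp only [hgf]
      congr 3
      ring
    rw [hl, hn2, hgθ, hgd, hw]
    obtain ⟨m, rfl⟩ : ∃ m, n = m + 1 := ⟨n - 1, by omega⟩
    have e1 : 2 * (m + 1) - 1 = 2 * m + 1 := by omega
    rw [e1, mul_pow, ← pow_mul, show (4 : ℝ) = 2 ^ 2 by norm_num, ← pow_mul]
    simp only
    generalize Real.sin (θ * s / 2) = S at *
    generalize Real.cos (θ * s / 2) = C at *
    have e2 : (S / θ) ^ (2 * (m + 1)) = (S / θ) ^ (2 * m + 1) * (S / θ) := by ring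
    rw [e2]
    generalize (S / θ) ^ (2 * m + 1) = P
    have e3 : (2 : ℝ) ^ (2 * (m + 1) + 2) = 2 ^ (2 * (m + 1)) * 4 := by ring
    rw [e3]
    generalize (2 : ℝ) ^ (2 * (m + 1)) = Q
    field_simp
    ring
  · intro v t
    ext
    · simp [smul_smul]
      ring
    · simp
      ring
end

section
/- Let n ≥ 1 be an integer, s ∈ (0,1], χ ∈ ℂⁿ \ {0} and θ ∈ (−2π,2π). Then, with Γ_s = Γ_s^0 (the case ε = 0), the Jacobian Jac(Γ_s)(χ,θ) is strictly positive; in particular Jac(Γ_s)(χ,θ) ≠ 0. -/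
open Real

lemma hg_det (n : ℕ) (g : ℂ) (hg : g ≠ 0) (w : EuclideanSpace ℂ (Fin n)) (c : ℝ)
    (l : EuclideanSpace ℂ (Fin n) →ₗ[ℝ] ℝ)
    (L : (EuclideanSpace ℂ (Fin n) × ℝ) →ₗ[ℝ] (EuclideanSpace ℂ (Fin n) × ℝ))
    (hL : ∀ v t, L (v, t) = (g • v + t • w, l v + t * c)) (hc : 0 < c - l (g⁻¹ • w)) :
    0 < LinearMap.det L := by
  let G : EuclideanSpace ℂ (Fin n) →ₗ[ℂ] EuclideanSpace ℂ (Fin n) := g • LinearMap.id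
  let Gi : EuclideanSpace ℂ (Fin n) →ₗ[ℂ] EuclideanSpace ℂ (Fin n) := g⁻¹ • LinearMap.id
  let d : ℝ := c - l (g⁻¹ • w)
  let D := LinearMap.prodMap (G.restrictScalars ℝ) (d • (LinearMap.id : ℝ →ₗ[ℝ] ℝ))
  let T1 := LinearMap.transvection
    ((l ∘ₗ Gi.restrictScalars ℝ) ∘ₗ LinearMap.fst ℝ (EuclideanSpace ℂ (Fin n)) ℝ)
    ((0 : EuclideanSpace ℂ (Fin n)), (1 : ℝ))
  let T2 := LinearMap.transvection (LinearMap.snd ℝ (EuclideanSpace ℂ (Fin n)) ℝ)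
    (g⁻¹ • w, (0 : ℝ))
  have h1 : LinearMap.det T1 = 1 := by
    simp [T1, LinearMap.transvection.det]
  have h2 : LinearMap.det T2 = 1 := by
    simp [T2, LinearMap.transvection.det]
  have hD : LinearMap.det D = Complex.normSq g ^ n * d := by
    have hG : LinearMap.det (G.restrictScalars ℝ) = Complex.normSq g ^ n := by
      rw [LinearMap.det_restrictScalars, Algebra.norm_complex_eq]
      simp [G]
    simp only [D]
    rw [LinearMap.det_prodMap, hG]
    simp
  have hcomp : L = T1 ∘ₗ D ∘ₗ T2 := by
    refine LinearMap.ext fun p => ?_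
    obtain ⟨v, t⟩ := p
    have e1 : g • (t • g⁻¹ • w) = t • w := by
      rw [smul_comm t g⁻¹ w, smul_inv_smul₀ hg]
    have e2 : g⁻¹ • (t • w) = t • (g⁻¹ • w) := smul_comm _ _ _
    rw [hL]
    simp only [T1, D, T2, G, Gi, LinearMap.comp_apply, LinearMap.transvection.apply,
      LinearMap.prodMap_apply, LinearMap.snd_apply, LinearMap.fst_apply,
      LinearMap.restrictScalars_apply, LinearMap.smul_apply, LinearMap.id_apply,
      Prod.smul_mk, Prod.mk_add_mk, smul_add, e1, inv_smul_smul₀ hg, e2, map_add, map_smul,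
      smul_zero, add_zero, smul_eq_mul, Prod.mk.injEq]
    refine ⟨trivial, ?_⟩
    rw [smul_inv_smul₀ hg]
    simp only [d]
    ring
  rw [hcomp, LinearMap.det_comp, LinearMap.det_comp, h1, h2, hD]
  have : 0 < Complex.normSq g := Complex.normSq_pos.2 hg
  simp only [one_mul, mul_one]
  exact mul_pos (pow_pos this n) hc

lemma hg_trig_pos {x : ℝ} (h0 : 0 < x) (h1 : x < 2 * π) : 0 < 2 - 2 * cos x - x * sin x := by
  have hmono : StrictMonoOn (fun y => sin y - y * cos y) (Set.Icc 0 π) := by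
    apply strictMonoOn_of_deriv_pos (convex_Icc _ _) (by fun_prop)
    intro y hy
    rw [interior_Icc] at hy
    have : HasDerivAt (fun y => sin y - y * cos y) (cos y - (1 * cos y + y * (-sin y))) y :=
      (hasDerivAt_sin y).sub ((hasDerivAt_id y).mul (hasDerivAt_cos y))
    rw [this.deriv]
    have := mul_pos hy.1 (sin_pos_of_mem_Ioo hy)
    linarith
  have h := hmono (a := 0) (b := x / 2) ⟨le_rfl, pi_pos.le⟩ ⟨by linarith, by linarith⟩ (by linarith)
  simp only [sin_zero, zero_mul, sub_zero] at h
  have hs : 0 < sin (x / 2) := sin_pos_of_pos_of_lt_pi (by linarith) (by linarith)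
  have e1 : cos x = 1 - 2 * sin (x / 2) ^ 2 := by
    rw [← cos_sq_add_sin_sq (x / 2)] 
    have := cos_two_mul (x / 2)
    rw [mul_div_cancel₀ x two_ne_zero] at this
    have := cos_sq_add_sin_sq (x / 2)
    linarith
  have e2 : sin x = 2 * sin (x / 2) * cos (x / 2) := by
    rw [← sin_two_mul, mul_div_cancel₀ x two_ne_zero]
  rw [e1, e2]
  nlinarith [mul_pos hs h]

lemma hg_trig_pos_abs {x : ℝ} (h0 : x ≠ 0) (h1 : |x| < 2 * π) :
    0 < 2 - 2 * cos x - x * sin x := by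
  rcases lt_or_gt_of_ne h0 with h | h
  · have := hg_trig_pos (x := -x) (by linarith) (by rwa [abs_of_neg h] at h1)
    simpa using this
  · exact hg_trig_pos h (by rwa [abs_of_pos h] at h1)

lemma hg_cos_lt {x : ℝ} (h0 : x ≠ 0) (h1 : |x| < 2 * π) : 0 < 1 - cos x := by
  have h2 := abs_lt.1 h1
  have : cos x ≠ 1 := fun h => h0 ((cos_eq_one_iff_of_lt_of_lt h2.1 h2.2).1 h)
  have := lt_of_le_of_ne (cos_le_one x) this
  linarith

noncomputable def hgG (s θ : ℝ) : ℂ :=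
  if θ = 0 then (s : ℂ)
  else Complex.I * ((Complex.exp (-Complex.I * ((θ * s : ℝ) : ℂ)) - 1) / (θ : ℂ))

noncomputable def hgH (s θ : ℝ) : ℝ := 2 * (θ * s - sin (θ * s)) / θ ^ 2

lemma hg_eq (n : ℕ) (s : ℝ) : heisenbergGamma n s 0 =
    fun p => (hgG s p.2 • p.1, (∑ i, ‖p.1 i‖ ^ 2) * hgH s p.2) := by
  funext p
  rw [← EuclideanSpace.norm_sq_eq]
  unfold heisenbergGamma hgG hgH
  split_ifs with h
  · simp [h]
  · simp only [Prod.mk.injEq, true_and]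
    ring

lemma hg_key (n : ℕ) (s : ℝ) (χ : EuclideanSpace ℂ (Fin n)) (hχ : χ ≠ 0) (θ : ℝ) (g' : ℂ) (h' : ℝ)
    (hg : HasDerivAt (hgG s) g' θ) (hh : HasDerivAt (hgH s) h' θ) (h0 : hgG s θ ≠ 0)
    (hpos : 0 < h' - 2 * hgH s θ * ((hgG s θ)⁻¹ * g').re) :
    0 < LinearMap.det (fderiv ℝ (heisenbergGamma n s 0) (χ, θ)).toLinearMap := by
  have hfst : HasFDerivAt (fun p : EuclideanSpace ℂ (Fin n) × ℝ => p.1)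
      (ContinuousLinearMap.fst ℝ _ _) (χ, θ) := hasFDerivAt_fst
  have hsnd : HasFDerivAt (fun p : EuclideanSpace ℂ (Fin n) × ℝ => p.2)
      (ContinuousLinearMap.snd ℝ _ _) (χ, θ) := hasFDerivAt_snd
  have hco : ∀ i, HasFDerivAt (fun p : EuclideanSpace ℂ (Fin n) × ℝ => p.1 i)
      (((EuclideanSpace.proj i : EuclideanSpace ℂ (Fin n) →L[ℂ] ℂ).restrictScalars ℝ).comp
        (ContinuousLinearMap.fst ℝ _ _)) (χ, θ) := fun i =>
    ((EuclideanSpace.proj i : EuclideanSpace ℂ (Fin n) →L[ℂ] ℂ).restrictScalars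
      ℝ).hasFDerivAt.comp (χ, θ) hfst
  have hG : HasFDerivAt (fun p : EuclideanSpace ℂ (Fin n) × ℝ => hgG s p.2) _ (χ, θ) :=
    HasFDerivAt.comp (g := hgG s) (χ, θ) hg.hasFDerivAt hsnd
  have hH : HasFDerivAt (fun p : EuclideanSpace ℂ (Fin n) × ℝ => hgH s p.2) _ (χ, θ) :=
    HasFDerivAt.comp (g := hgH s) (χ, θ) hh.hasFDerivAt hsnd
  have hN := HasFDerivAt.fun_sum (u := Finset.univ) fun i _ => (hco i).norm_sq
  have hF := (hG.smul hfst).prodMk (hN.mul hH)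
  let l : EuclideanSpace ℂ (Fin n) →ₗ[ℝ] ℝ :=
    { toFun := fun v => hgH s θ * ∑ i, 2 * inner ℝ (χ i) (v i)
      map_add' := by
        intro x y
        simp [inner_add_right, mul_add, Finset.sum_add_distrib]
      map_smul' := by
        intro r x
        simp only [PiLp.smul_apply, real_inner_smul_right, RingHom.id_apply, smul_eq_mul,
          Finset.mul_sum]
        exact Finset.sum_congr rfl fun i _ => by ring }
  have hfd := hF.fderiv
  have hNpos : 0 < ∑ i, ‖χ i‖ ^ 2 := by
    rw [← EuclideanSpace.norm_sq_eq]
    exact pow_pos (norm_pos_iff.2 hχ) 2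
  refine hg_det n (hgG s θ) h0 (g' • χ) ((∑ i, ‖χ i‖ ^ 2) * h') l _ ?_ ?_
  · intro v t
    rw [hg_eq]
    refine (DFunLike.congr_fun hfd (v, t)).trans ?_
    refine Prod.ext ?_ ?_
    · simp
      rw [mul_smul, Complex.coe_smul]
    · simp [l]
      ring
  · have : l ((hgG s θ)⁻¹ • g' • χ) =
        2 * hgH s θ * ((hgG s θ)⁻¹ * g').re * ∑ i, ‖χ i‖ ^ 2 := by
      change hgH s θ * ∑ i, 2 * inner ℝ (χ i) (((hgG s θ)⁻¹ • g' • χ) i) = _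
      rw [Finset.mul_sum, Finset.mul_sum]
      refine Finset.sum_congr rfl fun i _ => ?_
      rw [smul_smul, PiLp.smul_apply, Complex.inner, smul_eq_mul, ← Complex.normSq_eq_norm_sq]
      generalize (hgG s θ)⁻¹ * g' = k
      simp [Complex.normSq_apply]
      ring
    rw [this]
    nlinarith [mul_pos hNpos hpos]

lemma hg_derivG0 (s : ℝ) : ∃ g', HasDerivAt (hgG s) g' 0 := by
  let F : ℝ → ℂ := fun θ => Complex.I * (Complex.exp (-Complex.I * ((θ * s : ℝ) : ℂ)) - 1)
  have hd : HasDerivAt F (s : ℂ) 0 := by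
    have h1 : HasDerivAt (fun θ : ℝ => -Complex.I * ((θ * s : ℝ) : ℂ))
        (-Complex.I * ((1 * s : ℝ) : ℂ)) 0 :=
      (((hasDerivAt_id (0 : ℝ)).mul_const s).ofReal_comp).const_mul _
    have h2 := ((h1.cexp).sub_const 1).const_mul Complex.I
    convert! h2 using 1
    simp only [zero_mul, Complex.ofReal_zero, mul_zero, Complex.exp_zero, one_mul]
    rw [← mul_assoc]
    simp
  have hE : hgG s = dslope F 0 := by
    funext θ
    unfold hgG
    split_ifs with h
    · rw [h, dslope_same, hd.deriv]
    · rw [dslope_of_ne _ h, slope_def_module]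
      simp only [F, sub_zero, zero_mul, Complex.ofReal_zero, mul_zero, Complex.exp_zero, sub_self,
        Complex.real_smul, Complex.ofReal_inv]
      ring
  have han : AnalyticAt ℝ F 0 := by
    have h1 : AnalyticAt ℝ (fun θ : ℝ => ((θ * s : ℝ) : ℂ)) 0 :=
      (Complex.ofRealCLM.analyticAt _).comp (f := fun θ : ℝ => θ * s) (by fun_prop)
    have h2 : AnalyticAt ℝ Complex.exp (-Complex.I * (((0:ℝ) * s : ℝ) : ℂ)) :=
      (analyticAt_cexp).restrictScalars
    have h3 : AnalyticAt ℝ (fun θ : ℝ => -Complex.I * ((θ * s : ℝ) : ℂ)) 0 :=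
      analyticAt_const.mul h1
    exact analyticAt_const.mul ((AnalyticAt.comp (f := fun θ : ℝ => -Complex.I * ((θ * s : ℝ) : ℂ)) h2 h3).sub analyticAt_const)
  obtain ⟨p, hp⟩ := han
  rw [hE]
  exact ⟨_, hp.has_fpower_series_dslope_fslope.analyticAt.differentiableAt.hasDerivAt⟩

lemma hg_derivH0 {s : ℝ} (hs : 0 < s) (hs1 : s ≤ 1) : HasDerivAt (hgH s) (s ^ 3 / 3) 0 := by
  rw [hasDerivAt_iff_tendsto_slope, tendsto_iff_norm_sub_tendsto_zero]
  have hlim : Filter.Tendsto (fun t : ℝ => t ^ 2) (nhdsWithin 0 {0}ᶜ) (nhds 0) := by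
    have : Filter.Tendsto (fun t : ℝ => t ^ 2) (nhds 0) (nhds (0 ^ 2)) :=
      (continuous_pow 2).tendsto 0
    rw [zero_pow two_ne_zero] at this
    exact this.mono_left nhdsWithin_le_nhds
  refine squeeze_zero' (Filter.Eventually.of_forall fun _ => norm_nonneg _) ?_ hlim
  have hball : ∀ᶠ t : ℝ in nhdsWithin 0 {0}ᶜ, |t| < 1 := by
    apply nhdsWithin_le_nhds
    have := Metric.ball_mem_nhds (0 : ℝ) one_pos
    filter_upwards [this] with t ht
    simpa using ht
  filter_upwards [hball, self_mem_nhdsWithin] with t ht ht0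
  have ht0 : t ≠ 0 := ht0
  have hts : |t * s| ≤ |t| := by
    rw [abs_mul, abs_of_pos hs]
    exact mul_le_of_le_one_right (abs_nonneg _) hs1
  have hb := Real.sin_bound (x := t * s) (hts.trans ht.le)
  have e : slope (hgH s) 0 t - s ^ 3 / 3 =
      -2 * (sin (t * s) - (t * s - (t * s) ^ 3 / 6)) / t ^ 3 := by
    rw [slope_def_field]
    simp only [hgH]
    field_simp
    simp
    ring
  rw [e, Real.norm_eq_abs, abs_div, abs_mul, abs_pow, div_le_iff₀ (by positivity)]
  have h5 : |t * s| ^ 5 ≤ |t| ^ 5 := pow_le_pow_left₀ (abs_nonneg _) hts 5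
  have e5 : t ^ 2 * |t| ^ 3 = |t| ^ 5 := by rw [← sq_abs t]; ring
  rw [e5]
  have : |(-2 : ℝ)| = 2 := by norm_num
  rw [this]
  have : 0 ≤ |t| ^ 5 := by positivity
  linarith

lemma hg_derivG (s θ : ℝ) (hθ : θ ≠ 0) : hgG s θ = ⟨sin (θ * s) / θ, (cos (θ * s) - 1) / θ⟩ ∧
    HasDerivAt (hgG s) (⟨(s * cos (θ * s) * θ - sin (θ * s)) / θ ^ 2,
      (-(s * sin (θ * s)) * θ - (cos (θ * s) - 1)) / θ ^ 2⟩ : ℂ) θ := by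
  have key : ∀ t : ℝ, t ≠ 0 → hgG s t =
      ((sin (t * s) / t : ℝ) : ℂ) + ((((cos (t * s) - 1) / t : ℝ)) : ℂ) * Complex.I := by
    intro t ht
    rw [hgG, if_neg ht]
    have : -Complex.I * ((t * s : ℝ) : ℂ) = ((-(t * s) : ℝ) : ℂ) * Complex.I := by
      push_cast; ring
    rw [this, Complex.exp_mul_I, ← Complex.ofReal_cos, ← Complex.ofReal_sin, cos_neg, sin_neg]
    have htc : (t : ℂ) ≠ 0 := by exact_mod_cast ht
    rw [Complex.ofReal_neg, Complex.ofReal_div, Complex.ofReal_div, Complex.ofReal_sub,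
      Complex.ofReal_one]
    field_simp
    linear_combination (-(sin (t * s) : ℂ)) * Complex.I_sq
  constructor
  · rw [key θ hθ, Complex.mk_eq_add_mul_I]
  · have hm : HasDerivAt (fun t : ℝ => t * s) s θ := by
      simpa using (hasDerivAt_id θ).mul_const s
    have h1 : HasDerivAt (fun t : ℝ => sin (t * s) / t)
        ((s * cos (θ * s) * θ - sin (θ * s)) / θ ^ 2) θ := by
      convert! (hm.sin).div (hasDerivAt_id θ) hθ using 1
      simp; ring
    have h2 : HasDerivAt (fun t : ℝ => (cos (t * s) - 1) / t)
        ((-(s * sin (θ * s)) * θ - (cos (θ * s) - 1)) / θ ^ 2) θ := by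
      convert! ((hm.cos).sub_const 1).div (hasDerivAt_id θ) hθ using 1
      simp; ring
    rw [Complex.mk_eq_add_mul_I]
    refine (h1.ofReal_comp.add (h2.ofReal_comp.mul_const Complex.I)).congr_of_eventuallyEq ?_
    filter_upwards [isOpen_ne.mem_nhds hθ] with t ht
    exact key t ht

lemma hg_derivH (s θ : ℝ) (hθ : θ ≠ 0) : HasDerivAt (hgH s)
    (2 * (s - s * cos (θ * s)) / θ ^ 2 - 4 * (θ * s - sin (θ * s)) / θ ^ 3) θ := by
  have hm : HasDerivAt (fun t : ℝ => t * s) s θ := by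
    simpa using (hasDerivAt_id θ).mul_const s
  have h := ((hm.sub hm.sin).const_mul 2).div (hasDerivAt_pow 2 θ) (pow_ne_zero 2 hθ)
  convert! h using 1
  simp
  field_simp
  ring

theorem heisenbergGamma_jacobian_pos (n : ℕ) (hn : 1 ≤ n) (s : ℝ)
    (hs : s ∈ Set.Ioc (0 : ℝ) 1) (χ : EuclideanSpace ℂ (Fin n)) (hχ : χ ≠ 0)
    (θ : ℝ) (hθ : θ ∈ Set.Ioo (-(2 * Real.pi)) (2 * Real.pi)) :
    0 < LinearMap.det (fderiv ℝ (heisenbergGamma n s 0) (χ, θ)).toLinearMap := by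
  obtain ⟨hs0, hs1⟩ := hs
  by_cases h0 : θ = 0
  · subst h0
    obtain ⟨g', hg⟩ := hg_derivG0 s
    refine hg_key n s χ hχ 0 g' _ hg (hg_derivH0 hs0 hs1) ?_ ?_
    · simp [hgG, hs0.ne']
    · simp [hgH]
      positivity
  · have hx0 : θ * s ≠ 0 := mul_ne_zero h0 hs0.ne'
    have hx : |θ * s| < 2 * π := by
      rw [abs_mul, abs_of_pos hs0]
      exact (mul_le_of_le_one_right (abs_nonneg _) hs1).trans_lt (abs_lt.2 hθ)
    have hc := hg_cos_lt hx0 hx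
    have hp := hg_trig_pos_abs hx0 hx
    obtain ⟨hG, hdG⟩ := hg_derivG s θ h0
    refine hg_key n s χ hχ θ _ _ hdG (hg_derivH s θ h0) ?_ ?_
    · rw [hG]
      intro h
      have := congrArg Complex.im h
      simp [h0] at this
      linarith
    · have hre : ((hgG s θ)⁻¹ * (⟨(s * cos (θ * s) * θ - sin (θ * s)) / θ ^ 2,
          (-(s * sin (θ * s)) * θ - (cos (θ * s) - 1)) / θ ^ 2⟩ : ℂ)).re =
          s * sin (θ * s) / (2 * (1 - cos (θ * s))) - 1 / θ := by
        have hn : Complex.normSq (hgG s θ) = 2 * (1 - cos (θ * s)) / θ ^ 2 := by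
          rw [hG, Complex.normSq_mk]
          have := sin_sq_add_cos_sq (θ * s)
          field_simp
          linarith
        rw [Complex.mul_re, Complex.inv_re, Complex.inv_im, hn, hG]
        have := sin_sq_add_cos_sq (θ * s)
        generalize cos (θ * s) = C at *
        generalize sin (θ * s) = S at *
        have hC := hc.ne'
        field_simp
        linear_combination (-1) * this
      rw [hre]
      have e : 2 * (s - s * cos (θ * s)) / θ ^ 2 - 4 * (θ * s - sin (θ * s)) / θ ^ 3 -
          2 * hgH s θ * (s * sin (θ * s) / (2 * (1 - cos (θ * s))) - 1 / θ) =
          2 * s / (θ ^ 2 * (1 - cos (θ * s))) * (2 - 2 * cos (θ * s) - θ * s * sin (θ * s)) := by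
        unfold hgH
        have := sin_sq_add_cos_sq (θ * s)
        generalize cos (θ * s) = C at *
        generalize sin (θ * s) = S at *
        have hC := hc.ne'
        field_simp
        linear_combination (2 * θ * s) * this
      rw [e]
      positivity
end
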